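/- arXiv:2305.12486 — 5 statements merged into one kernel-verified Lean document; each statement's English description precedes it below -/
import Mathlib

section
/- Let T ⊆ 2^{<ω} be a perfect tree and let F : 2^ℕ → ℕ^ℕ be continuous. Then either there is a string s ∈ T such that the restriction of F to [T↾s] is constant, or there is a perfect tree S ⊆ T such that the restriction of F to [S] is injective. -/
open Set

/-- A tree on binary strings: a set of finite binary strings closed under initial segments. -/
def IsTree (T : Set (List Bool)) : Prop :=
  ∀ ⦃s t : List Bool⦄, s <+: t → t ∈ T → s ∈ T

/-- The restriction `T↾s = {t ∈ T : s ⊆ t ∨ t ⊆ s}`. -/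
def restr (T : Set (List Bool)) (s : List Bool) : Set (List Bool) :=
  {t ∈ T | s <+: t ∨ t <+: s}

/-- A perfect tree: a nonempty tree with no endpoints and no isolated branches, i.e.
every node extends to a branching node. -/
def IsPerfect (T : Set (List Bool)) : Prop :=
  IsTree T ∧ T.Nonempty ∧
    ∀ s ∈ T, ∃ t ∈ T, s <+: t ∧ t ++ [false] ∈ T ∧ t ++ [true] ∈ T

/-- The initial segment `a↾n` of an infinite binary sequence. -/
def seg (a : ℕ → Bool) (n : ℕ) : List Bool := (List.range n).map a

/-- The initial segment `b↾n` of an element of Baire space. -/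
def segN (b : ℕ → ℕ) (n : ℕ) : List ℕ := (List.range n).map b

/-- The branch set `[T] = {a ∈ 2^ℕ : ∀ n, a↾n ∈ T}`. -/
def branches (T : Set (List Bool)) : Set (ℕ → Bool) := {a | ∀ n, seg a n ∈ T}

/-- The inclusion `ι : 2^ℕ → ℕ^ℕ` induced by `{0,1} ⊆ ℕ`. -/
def iota (a : ℕ → Bool) : ℕ → ℕ := fun n => (a n).toNat

/-- `r` is the root of `T`: the largest string with `T↾r = T`. -/
def IsRoot (T : Set (List Bool)) (r : List Bool) : Prop :=
  r ∈ T ∧ restr T r = T ∧ ∀ s ∈ T, restr T s = T → s <+: r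

/-- The root of a (perfect) tree, via choice. -/
noncomputable def root (T : Set (List Bool)) : List Bool :=
  Classical.epsilon fun r => IsRoot T r

/-- `T⇂i = T↾(roo(T)⌢i)`. -/
noncomputable def splitOne (T : Set (List Bool)) (i : Bool) : Set (List Bool) :=
  restr T (root T ++ [i])

/-- Iterated splitting `T⇂s`, with `T⇂Λ = T` and `T⇂(s⌢i) = (T⇂s)⇂i`. -/
noncomputable def splitAt (T : Set (List Bool)) (s : List Bool) : Set (List Bool) :=
  s.foldl splitOne T

/-- A splitting system: perfect trees `T_s` with `T_{s⌢i} ⊆ T_s⇂i`. -/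
def IsSplittingSystem (Tf : List Bool → Set (List Bool)) : Prop :=
  (∀ s, IsPerfect (Tf s)) ∧ ∀ (s : List Bool) (i : Bool), Tf (s ++ [i]) ⊆ splitOne (Tf s) i

/-- `S` is clopen in `T`: `S = ⋃_{s∈A} T↾s` for some finite `A ⊆ T`. -/
def ClopenIn (S T : Set (List Bool)) : Prop :=
  ∃ A : Set (List Bool), A.Finite ∧ A ⊆ T ∧ S = ⋃ s ∈ A, restr T s

/-- Functional perfect trees: codes for continuous functions `2^ℕ → ℕ^ℕ`. -/
def IsFPT (c : Set (List Bool × List ℕ)) : Prop :=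
  (∀ p ∈ c, p.1.length = p.2.length) ∧
  (∀ p ∈ c, ∀ n ≤ p.1.length, (p.1.take n, p.2.take n) ∈ c) ∧
  (∀ s : List Bool, ∃ u : List ℕ, (s, u) ∈ c) ∧
  (∀ p ∈ c, ∀ i : Bool, ∃ k : ℕ, (p.1 ++ [i], p.2 ++ [k]) ∈ c) ∧
  (∀ m : ℕ, ∃ k, m ≤ k ∧ ∀ s : List Bool, s.length = k →
      ∃ us : List ℕ, us.length = m ∧ ∀ u : List ℕ, (s, u) ∈ c → us <+: u)

/-- The code `cod(F) = {(a↾n, F(a)↾n) : a ∈ 2^ℕ, n ∈ ℕ}` of a function `F`. -/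
def cod (F : (ℕ → Bool) → ℕ → ℕ) : Set (List Bool × List ℕ) :=
  {p | ∃ (a : ℕ → Bool) (n : ℕ), p = (seg a n, segN (F a) n)}

/-- The relation `f_c` coded by `c`. -/
def fc (c : Set (List Bool × List ℕ)) : Set ((ℕ → Bool) × (ℕ → ℕ)) :=
  {q | ∀ m, (seg q.1 m, segN q.2 m) ∈ c}

theorem seg_eq_iff (a b : ℕ → Bool) (n : ℕ) : seg a n = seg b n ↔ ∀ i < n, a i = b i := by
  simp [seg]

theorem seg_length (a : ℕ → Bool) (n : ℕ) : (seg a n).length = n := by simp [seg]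

theorem seg_take (a : ℕ → Bool) {m n : ℕ} (h : m ≤ n) : (seg a n).take m = seg a m := by
  simp [seg, ← List.map_take, List.take_range, h]

theorem seg_prefix (a : ℕ → Bool) {m n : ℕ} (h : m ≤ n) : seg a m <+: seg a n := by
  rw [← seg_take a h]; exact List.take_prefix _ _

theorem prefix_seg {s t : List Bool} {x : ℕ → Bool} (h : s <+: t) (ht : seg x t.length = t) :
    seg x s.length = s := by
  rw [← seg_take x h.length_le, ht]
  exact (List.prefix_iff_eq_take.1 h).symm

theorem split_lists : ∀ (c d : List Bool), c.length = d.length → c ≠ d →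
    ∃ (p : List Bool) (i : Bool), p ++ [i] <+: c ∧ p ++ [!i] <+: d := by
  intro c
  induction c with
  | nil => intro d h hne; cases d <;> simp_all
  | cons x c ih =>
    intro d h hne
    cases d with
    | nil => simp at h
    | cons y d =>
      by_cases hxy : x = y
      · subst hxy
        obtain ⟨p, i, h1, h2⟩ := ih d (by simpa using h) (by simpa using hne)
        exact ⟨x :: p, i, by simpa using h1, by simpa using h2⟩
      · refine ⟨[], x, by simp, ?_⟩
        have : y = !x := by cases x <;> cases y <;> simp_all
        simp [this]

theorem split_incomp : ∀ (c d : List Bool), ¬ c <+: d → ¬ d <+: c →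
    ∃ (p : List Bool) (i : Bool), p ++ [i] <+: c ∧ p ++ [!i] <+: d := by
  intro c
  induction c with
  | nil => intro d h hne; simp at h
  | cons x c ih =>
    intro d h hne
    cases d with
    | nil => simp at hne
    | cons y d =>
      by_cases hxy : x = y
      · subst hxy
        obtain ⟨p, i, h1, h2⟩ := ih d (by simpa using h) (by simpa using hne)
        exact ⟨x :: p, i, by simpa using h1, by simpa using h2⟩
      · refine ⟨[], x, by simp, ?_⟩
        have : y = !x := by cases x <;> cases y <;> simp_all
        simp [this]

theorem cont_seg (F : (ℕ → Bool) → ℕ → ℕ) (hF : Continuous F) (a : ℕ → Bool) (k : ℕ) :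
    ∃ N, ∀ x, seg x N = seg a N → F x k = F a k := by
  have hc : Continuous fun x => F x k := (continuous_apply k).comp hF
  have ho : IsOpen {x | F x k = F a k} := (isOpen_discrete {F a k}).preimage hc
  obtain ⟨v, ⟨y, n, rfl⟩, hav, hsub⟩ :=
    (PiNat.isTopologicalBasis_cylinders (fun _ : ℕ => Bool)).exists_subset_of_mem_open
      (show a ∈ {x | F x k = F a k} from rfl) ho
  refine ⟨n, fun x hx => hsub ?_⟩
  rw [seg_eq_iff] at hx
  intro i hi
  rw [hx i hi]
  exact hav i hi

theorem foldl_prefix (g : List Bool → Bool → List Bool) (T : Set (List Bool))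
    (hgT : ∀ s ∈ T, ∀ i, g s i ∈ T) (hp : ∀ s ∈ T, ∀ i, s <+: g s i) (v : List Bool) :
    ∀ s ∈ T, v.foldl g s ∈ T ∧ s <+: v.foldl g s := by
  induction v with
  | nil => intro s hs; exact ⟨hs, List.prefix_rfl⟩
  | cons i v ih =>
    intro s hs
    obtain ⟨h1, h2⟩ := ih (g s i) (hgT s hs i)
    exact ⟨h1, (hp s hs i).trans h2⟩

/-- If `T` is a perfect tree and `F : 2^ℕ → ℕ^ℕ` is continuous, then either `F` is
constant on `[T↾s]` for some `s ∈ T`, or `F` is injective on `[S]` for some perfect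
subtree `S ⊆ T`. -/
theorem stmt_0 (T : Set (List Bool)) (hT : IsPerfect T)
    (F : (ℕ → Bool) → ℕ → ℕ) (hF : Continuous F) :
    (∃ s ∈ T, ∀ a ∈ branches (restr T s), ∀ b ∈ branches (restr T s), F a = F b) ∨
    (∃ S : Set (List Bool), IsPerfect S ∧ S ⊆ T ∧ Set.InjOn F (branches S)) := by
  by_cases hcon : ∃ s ∈ T, ∀ a ∈ branches (restr T s), ∀ b ∈ branches (restr T s), F a = F b
  · exact Or.inl hcon
  right
  push Not at hcon
  obtain ⟨hTree, ⟨t0, ht0⟩, -⟩ := hT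
  have hnil : ([] : List Bool) ∈ T := hTree (List.nil_prefix) ht0
  have key : ∀ s : List Bool, ∃ f : Bool → List Bool, s ∈ T →
      (∀ i, f i ∈ T) ∧ (∀ i, s <+: f i) ∧ (f false).length = (f true).length ∧
      f false ≠ f true ∧
      (∀ x y : ℕ → Bool, seg x (f false).length = f false → seg y (f true).length = f true →
        F x ≠ F y) := by
    intro s
    by_cases hs : s ∈ T
    swap
    · exact ⟨fun _ => [], fun h => absurd h hs⟩
    obtain ⟨a, ha, b, hb, hab⟩ := hcon s hs
    obtain ⟨k, hk⟩ := Function.ne_iff.1 hab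
    obtain ⟨N1, h1⟩ := cont_seg F hF a k
    obtain ⟨N2, h2⟩ := cont_seg F hF b k
    let N := max s.length (max N1 N2)
    have hN : s.length ≤ N := le_max_left _ _
    have hN1 : N1 ≤ N := (le_max_left _ _).trans (le_max_right _ _)
    have hN2 : N2 ≤ N := (le_max_right _ _).trans (le_max_right _ _)
    have hsep : ∀ x y : ℕ → Bool, seg x N = seg a N → seg y N = seg b N → F x ≠ F y := by
      intro x y hx hy hxy
      have e1 := h1 x (by rw [← seg_take x hN1, ← seg_take a hN1, hx])
      have e2 := h2 y (by rw [← seg_take y hN2, ← seg_take b hN2, hy])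
      rw [hxy] at e1
      exact hk (e1.symm.trans e2)
    have hpre : ∀ c ∈ branches (restr T s), s <+: seg c N := by
      intro c hc
      rcases (hc N).2 with h | h
      · exact h
      · rw [h.eq_of_length_le (by rw [seg_length]; exact hN)]
    refine ⟨fun i => if i then seg b N else seg a N, fun _ => ⟨?_, ?_, ?_, ?_, ?_⟩⟩
    · intro i; cases i
      · exact (ha N).1
      · exact (hb N).1
    · intro i; cases i
      · exact hpre a ha
      · exact hpre b hb
    · simp [seg_length]
    · intro h
      exact hsep a a rfl (by simpa using h) rfl
    · intro x y hx hy
      simp only [Bool.false_eq_true, if_false, if_true, seg_length] at hx hy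
      exact hsep x y hx hy
  choose g hg using key
  have hgT : ∀ s ∈ T, ∀ i, g s i ∈ T := fun s hs => (hg s hs).1
  have hgp : ∀ s ∈ T, ∀ i, s <+: g s i := fun s hs => (hg s hs).2.1
  have hlen : ∀ s ∈ T, ∀ i j, (g s i).length = (g s j).length := by
    intro s hs i j
    have := (hg s hs).2.2.1
    cases i <;> cases j <;> simp [this]
  have hne : ∀ s ∈ T, ∀ i, g s i ≠ g s (!i) := by
    intro s hs i
    have := (hg s hs).2.2.2.1
    cases i
    · exact this
    · exact this.symm
  have hFne : ∀ s ∈ T, ∀ i, ∀ x y : ℕ → Bool, seg x (g s i).length = g s i →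
      seg y (g s (!i)).length = g s (!i) → F x ≠ F y := by
    intro s hs i x y hx hy
    have := (hg s hs).2.2.2.2
    cases i
    · exact this x y hx hy
    · exact (this y x hy hx).symm
  let h : List Bool → List Bool := fun u => u.foldl g []
  have hhT : ∀ u, h u ∈ T := fun u => (foldl_prefix g T hgT hgp u [] hnil).1
  have hhs : ∀ u i, h (u ++ [i]) = g (h u) i := by intro u i; simp [h]
  have hmono : ∀ u v, u <+: v → h u <+: h v := by
    rintro u _ ⟨w, rfl⟩
    have := (foldl_prefix g T hgT hgp w (h u) (hhT u)).2
    simpa [h] using this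
  have hincomp : ∀ u v p i, p ++ [i] <+: u → p ++ [!i] <+: v → ¬ h u <+: h v := by
    intro u v p i hu hv huv
    have e1 := (hmono _ _ hu).trans huv
    have e2 := hmono _ _ hv
    rw [hhs] at e1 e2
    have hl := hlen (h p) (hhT p) i (!i)
    exact hne _ (hhT p) i ((List.prefix_of_prefix_length_le e1 e2 hl.le).eq_of_length hl)
  have hlt : ∀ s ∈ T, ∀ i, s.length < (g s i).length := by
    intro s hs i
    refine lt_of_le_of_ne (hgp s hs i).length_le fun he => ?_
    have e1 := (hgp s hs i).eq_of_length he
    have e2 := (hgp s hs (!i)).eq_of_length (he.trans (hlen s hs _ _))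
    exact hne s hs i (e1.symm.trans e2)
  have hlong : ∀ u, u.length ≤ (h u).length := by
    intro u
    induction u using List.reverseRecOn with
    | nil => simp
    | append_singleton u i ih =>
      rw [hhs]
      have := hlt (h u) (hhT u) i
      simp only [List.length_append, List.length_singleton]
      omega
  let S : Set (List Bool) := {t | ∃ u, t <+: h u}
  have hstep : ∀ x ∈ branches S, ∀ n, ∃ u : List Bool, u.length = n ∧
      seg x (h u).length = h u := by
    intro x hx n
    induction n with
    | zero => exact ⟨[], rfl, rfl⟩
    | succ n ih =>
      obtain ⟨u, hu, hxu⟩ := ih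
      obtain ⟨v, hv⟩ := hx (g (h u) false).length
      have huv : h u <+: h v := by
        rw [← hxu]
        exact (seg_prefix x (hlt _ (hhT u) _).le).trans hv
      have hex : ∃ w i, u ++ [i] <+: w ∧ h v <+: h w := by
        by_cases c1 : u <+: v
        · obtain ⟨w, rfl⟩ := c1
          cases w with
          | nil => exact ⟨u ++ [false], false, List.prefix_rfl, hmono _ _ (by simp)⟩
          | cons i w => exact ⟨u ++ i :: w, i, by simp, List.prefix_rfl⟩
        · by_cases c2 : v <+: u
          · exact ⟨u ++ [false], false, List.prefix_rfl,
              hmono _ _ (c2.trans (List.prefix_append _ _))⟩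
          · obtain ⟨p, i, h1, h2⟩ := split_incomp u v c1 c2
            exact absurd huv (hincomp u v p i h1 h2)
      obtain ⟨w, i, hw, hvw⟩ := hex
      refine ⟨u ++ [i], by simp [hu], ?_⟩
      have e1 := hv.trans hvw
      have e2 := hmono _ _ hw
      rw [hhs] at e2 ⊢
      rw [hlen _ (hhT u) false i] at e1
      exact (List.prefix_of_prefix_length_le e1 e2 (by rw [seg_length])).eq_of_length
        (by rw [seg_length])
  refine ⟨S, ⟨?_, ⟨[], [], List.nil_prefix⟩, ?_⟩, ?_, ?_⟩
  · rintro s t hst ⟨u, hu⟩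
    exact ⟨u, hst.trans hu⟩
  · rintro s ⟨u, hu⟩
    obtain ⟨c, hc⟩ := hgp _ (hhT u) false
    obtain ⟨d, hd⟩ := hgp _ (hhT u) true
    have hl := hlen _ (hhT u) false true
    have hn : g (h u) false ≠ g (h u) true := hne _ (hhT u) false
    rw [← hc, ← hd] at hl hn
    obtain ⟨p, i, h1, h2⟩ := split_lists c d (by simpa using hl) (by simpa using hn)
    have m1 : (h u ++ p) ++ [i] ∈ S := by
      refine ⟨u ++ [false], ?_⟩
      rw [hhs, ← hc, List.append_assoc]
      exact (List.prefix_append_right_inj _).2 h1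
    have m2 : (h u ++ p) ++ [!i] ∈ S := by
      refine ⟨u ++ [true], ?_⟩
      rw [hhs, ← hd, List.append_assoc]
      exact (List.prefix_append_right_inj _).2 h2
    refine ⟨h u ++ p, ?_, hu.trans (List.prefix_append _ _), ?_⟩
    · obtain ⟨w, hw⟩ := m1
      exact ⟨w, (List.prefix_append _ _).trans hw⟩
    · cases i
      · exact ⟨m1, m2⟩
      · exact ⟨m2, m1⟩
  · rintro s ⟨u, hu⟩
    exact hTree hu (hhT u)
  · intro x hx y hy hxy
    by_contra hne'
    obtain ⟨n, hn⟩ := Function.ne_iff.1 hne'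
    obtain ⟨u, hu, hxu⟩ := hstep x hx (n + 1)
    obtain ⟨v, hv, hyv⟩ := hstep y hy (n + 1)
    have huv : u ≠ v := by
      rintro rfl
      have := (seg_eq_iff _ _ _).1 (hxu.trans hyv.symm) n (by have := hlong u; omega)
      exact hn this
    obtain ⟨p, i, h1, h2⟩ := split_lists u v (hu.trans hv.symm) huv
    have e1 := prefix_seg (hmono _ _ h1) hxu
    have e2 := prefix_seg (hmono _ _ h2) hyv
    rw [hhs] at e1 e2
    exact hFne _ (hhT p) i x y e1 e2 hxy
end

section
/- Let T be a perfect tree, F : 2^ℕ → ℕ^ℕ continuous, and suppose F(a₀) ≠ ι(a₀) for some a₀ ∈ [T]. Then there is a string s ∈ T with a₀ ∈ [T↾s] such that the perfect tree S = T↾s satisfies F(a) ∉ ι([S]) for all a ∈ [S]. -/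
open Set

theorem agree_of_branch (T : Set (List Bool)) (a₀ a : ℕ → Bool) (N : ℕ)
    (ha : a ∈ branches (restr T (seg a₀ N))) : ∀ i < N, a i = a₀ i := by
  have h := (ha N).2
  have hl : (seg a₀ N).length = (seg a N).length := by simp [seg]
  have he : seg a₀ N = seg a N := by
    rcases h with h | h
    · exact h.eq_of_length hl
    · exact (h.eq_of_length hl.symm).symm
  intro i hi
  unfold seg at he
  exact (List.map_inj_left.1 he i (List.mem_range.2 hi)).symm

/-- If `F` is continuous and `F(a₀) ≠ ι(a₀)` for some branch `a₀` of a perfect tree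
`T`, then some restriction `S = T↾s` with `a₀ ∈ [S]` satisfies `F(a) ∉ ι([S])` for
all `a ∈ [S]`. -/
theorem stmt_11 (T : Set (List Bool)) (hT : IsPerfect T)
    (F : (ℕ → Bool) → ℕ → ℕ) (hF : Continuous F)
    (a₀ : ℕ → Bool) (ha₀ : a₀ ∈ branches T) (hne : F a₀ ≠ iota a₀) :
    ∃ s ∈ T, a₀ ∈ branches (restr T s) ∧
      ∀ a ∈ branches (restr T s), F a ∉ iota '' branches (restr T s) := by
  obtain ⟨n, hn⟩ := Function.ne_iff.1 hne
  have hopen : IsOpen {a | F a n = F a₀ n} :=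
    (isOpen_discrete {F a₀ n}).preimage ((continuous_apply n).comp hF)
  obtain ⟨I, u, hu, hsub⟩ := isOpen_pi_iff.1 hopen a₀ rfl
  refine ⟨seg a₀ (I.sup id + n + 1), ha₀ _, fun k => ⟨ha₀ k, ?_⟩, ?_⟩
  · rcases le_total (I.sup id + n + 1) k with h | h
    · exact Or.inl (seg_prefix a₀ h)
    · exact Or.inr (seg_prefix a₀ h)
  · rintro a ha ⟨b, hb, hab⟩
    have h1 := agree_of_branch T a₀ a _ ha
    have h2 := agree_of_branch T a₀ b _ hb
    have h3 : F a n = F a₀ n := by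
      apply hsub
      intro i hi
      have hle : i ≤ I.sup id := Finset.le_sup (f := id) hi
      rw [h1 i (by omega)]
      exact (hu i hi).2
    apply hn
    rw [← h3, ← hab]
    simp only [iota]
    rw [h2 n (by omega)]
end

section
/- If T is a perfect tree and X ⊆ 2^ℕ is countable, then there exists a perfect tree S ⊆ T with [S] ∩ X = ∅. -/
open Set

/-- A perfect tree has a perfect subtree whose branch set avoids any given countable
set. -/
theorem stmt_12 (T : Set (List Bool)) (hT : IsPerfect T)
    (X : Set (ℕ → Bool)) (hX : X.Countable) :
    ∃ S : Set (List Bool), IsPerfect S ∧ S ⊆ T ∧ branches S ∩ X = ∅ := by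
  classical
  rcases X.eq_empty_or_nonempty with rfl | hne
  · exact ⟨T, hT, subset_rfl, by simp⟩
  obtain ⟨x, rfl⟩ := hX.exists_eq_range hne
  obtain ⟨hTree, ⟨s0, hs0⟩, hBr⟩ := hT
  have step : ∀ (n : ℕ) (s : T), ∃ (e : Bool → T) (t : List Bool), s.1 <+: t ∧
      ∀ i, t ++ [i] <+: (e i).1 ∧ ∀ N, ¬ ((e i).1 <+: seg (x n) N) := by
    intro n s
    obtain ⟨t, -, hst, hf, ht⟩ := hBr s.1 s.2
    have key : ∀ i, ∃ r : T, t ++ [i] <+: r.1 ∧ ∀ N, ¬ (r.1 <+: seg (x n) N) := by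
      intro i
      have hi : t ++ [i] ∈ T := by cases i <;> assumption
      obtain ⟨u, -, htu, huf, hut⟩ := hBr _ hi
      have hb : ∀ b, u ++ [b] ∈ T := by intro b; cases b <;> assumption
      refine ⟨⟨u ++ [!(x n u.length)], hb _⟩, htu.trans (List.prefix_append _ _), ?_⟩
      intro N hN
      have h1 : u.length < (u ++ [!(x n u.length)]).length := by simp
      have h2 := hN.getElem h1
      simp [seg] at h2
    choose e he using key
    exact ⟨e, t, hst, he⟩
  choose e t hst he using step
  let g : List Bool → T :=
    fun l => List.rec ⟨[], hTree (List.nil_prefix) hs0⟩ (fun i l r => e l.length r i) l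
  have gc : ∀ i l, g (i :: l) = e l.length (g l) i := fun i l => rfl
  have mono1 : ∀ i l, (g l).1 <+: (g (i :: l)).1 := by
    intro i l
    rw [gc]
    exact ((hst _ _).trans (List.prefix_append _ _)).trans (he _ _ i).1
  have mono : ∀ k l, (g l).1 <+: (g (k ++ l)).1 := by
    intro k l
    induction k with
    | nil => exact List.prefix_rfl
    | cons i k ih => exact ih.trans (mono1 i (k ++ l))
  refine ⟨{s | ∃ l, s <+: (g l).1}, ⟨?_, ⟨_, [], List.prefix_rfl⟩, ?_⟩, ?_, ?_⟩
  · rintro s t hs ⟨l, hl⟩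
    exact ⟨l, hs.trans hl⟩
  · rintro s ⟨l, hl⟩
    have hm : ∀ i, t l.length (g l) ++ [i] <+: (g (i :: l)).1 := fun i => (he _ _ i).1
    exact ⟨t l.length (g l), ⟨false :: l, (List.prefix_append _ _).trans (hm false)⟩,
      hl.trans (hst _ _), ⟨false :: l, hm false⟩, ⟨true :: l, hm true⟩⟩
  · rintro s ⟨l, hl⟩
    exact hTree hl (g l).2
  · rw [Set.eq_empty_iff_forall_notMem]
    rintro a ⟨ha, n, rfl⟩
    obtain ⟨N, hN⟩ := ((List.finite_length_eq Bool (n + 1)).image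
      (fun l => (g l).1.length)).bddAbove
    obtain ⟨l, hl⟩ := ha N
    have hl2 := hl.trans (mono (List.replicate (n + 1) false) l)
    generalize hk : List.replicate (n + 1) false ++ l = k at hl2
    have hkl : n + 1 ≤ k.length := by rw [← hk]; simp
    have hdl : (k.drop (k.length - (n + 1))).length = n + 1 := by
      rw [List.length_drop]; omega
    have hm := mono (k.take (k.length - (n + 1))) (k.drop (k.length - (n + 1)))
    rw [List.take_append_drop] at hm
    generalize k.drop (k.length - (n + 1)) = d at hdl hm
    have hlen : (g d).1.length ≤ N := hN ⟨d, hdl, rfl⟩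
    have hp : (g d).1 <+: seg (x n) N :=
      List.prefix_of_prefix_length_le hm hl2 (by simpa [seg] using hlen)
    cases d with
    | nil => simp at hdl
    | cons i d =>
      have hd : d.length = n := by simpa using hdl
      subst hd
      exact (he _ _ i).2 N hp
end

section
/- Let J be a set of perfect trees such that whenever T ∈ J and S ⊆ T is a perfect tree clopen in T, then S ∈ J. Let (D_n)_{n≥1} be a sequence of subsets of J, each dense in J, and let S⁰ ∈ J. Then there is a splitting system (T_s)_{s∈2^{<ω}} of trees T_s ∈ J with T_Λ ⊆ S⁰ and T_s ∈ D_{|s|} for every s of length ≥ 1. Consequently the fusion T = ⋂_n ⋃_{s∈2^n} T_s is a perfect tree with T ⊆ S⁰ such that for every n ≥ 1 there is a finite set A ⊆ D_n with [S] ∩ [S'] = ∅ for all distinct S, S' ∈ A and [T] ⊆ ⋃_{S∈A} [S]. -/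
open Set

theorem comp_prefix {x r : List Bool} (h : ∀ i : Bool, x <+: r ++ [i] ∨ r ++ [i] <+: x) :
    x <+: r := by
  rcases h false with h0 | h0
  · rcases List.prefix_concat_iff.1 h0 with e | e
    · rcases h true with h1 | h1
      · rcases List.prefix_concat_iff.1 h1 with e1 | e1
        · rw [e] at e1; simp at e1
        · exact e1
      · have := h1.eq_of_length (by rw [e]; simp)
        rw [e] at this; simp at this
    · exact e
  · rcases h true with h1 | h1
    · have := (h0.trans h1).eq_of_length (by simp)
      simp at this
    · have := List.prefix_of_prefix_length_le h0 h1 (by simp)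
      have := this.eq_of_length (by simp)
      simp at this

theorem common_prefix (s r : List Bool) : s <+: r ∨ r <+: s ∨
    ∃ p i, p ++ [i] <+: s ∧ p ++ [!i] <+: r := by
  induction s generalizing r with
  | nil => left; simp
  | cons a s ih =>
    cases r with
    | nil => right; left; simp
    | cons b r =>
      by_cases hab : a = b
      · subst hab
        rcases ih r with h | h | ⟨p, i, h1, h2⟩
        · left; simpa using h
        · right; left; simpa using h
        · right; right; exact ⟨a :: p, i, by simpa using h1, by simpa using h2⟩
      · right; right
        refine ⟨[], a, by simp, ?_⟩
        have : (!a) = b := by cases a <;> cases b <;> simp_all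
        simp [this]

theorem exists_root {T : Set (List Bool)} (hT : IsPerfect T) :
    ∃ r, IsRoot T r ∧ ∀ i : Bool, r ++ [i] ∈ T := by
  classical
  obtain ⟨tr, ⟨x, hx⟩, hb⟩ := hT
  have hex : ∃ n, ∃ t : List Bool, t.length = n ∧ ∀ i : Bool, t ++ [i] ∈ T := by
    obtain ⟨t, _, _, h0, h1⟩ := hb x hx
    exact ⟨_, t, rfl, fun i => by cases i <;> assumption⟩
  obtain ⟨r, hr, hri⟩ := Nat.find_spec hex
  have hmin : ∀ t : List Bool, (∀ i : Bool, t ++ [i] ∈ T) → r.length ≤ t.length := by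
    intro t ht
    rw [hr]
    exact Nat.find_min' hex ⟨t, rfl, ht⟩
  have hrT : r ∈ T := tr (List.prefix_append r [true]) (hri true)
  refine ⟨r, ⟨hrT, ?_, ?_⟩, hri⟩
  · ext s
    constructor
    · exact fun h => h.1
    · intro hs
      refine ⟨hs, ?_⟩
      rcases common_prefix s r with h | h | ⟨p, i, h1, h2⟩
      · exact Or.inr h
      · exact Or.inl h
      · exfalso
        have := hmin p (fun j => by
          by_cases hj : j = i
          · subst hj; exact tr h1 hs
          · have : j = !i := by cases i <;> cases j <;> simp_all
            subst this; exact tr h2 hrT)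
        have h3 := h2.length_le
        simp at h3
        omega
  · intro s _ hse
    apply comp_prefix
    intro i
    have h : r ++ [i] ∈ restr T s := by rw [hse]; exact hri i
    exact h.2

theorem root_spec {T : Set (List Bool)} (hT : IsPerfect T) :
    (∀ i : Bool, root T ++ [i] ∈ T) ∧ root T ∈ T ∧
      ∀ t ∈ T, root T <+: t ∨ t <+: root T := by
  obtain ⟨r, hr, hri⟩ := exists_root hT
  have hR : IsRoot T (root T) := Classical.epsilon_spec (p := fun r => IsRoot T r) ⟨r, hr⟩
  have e : root T = r := by
    have h1 := hr.2.2 _ hR.1 hR.2.1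
    have h2 := hR.2.2 _ hr.1 hr.2.1
    exact h1.eq_of_length (le_antisymm h1.length_le h2.length_le)
  refine ⟨fun i => by rw [e]; exact hri i, hR.1, fun t ht => ?_⟩
  rw [← hR.2.1] at ht
  exact ht.2

theorem restr_perfect {T : Set (List Bool)} (hT : IsPerfect T) {s : List Bool} (hs : s ∈ T) :
    IsPerfect (restr T s) := by
  obtain ⟨tr, hne, hb⟩ := hT
  refine ⟨?_, ⟨s, hs, Or.inl (List.prefix_refl s)⟩, ?_⟩
  · rintro u t hut ⟨htT, h | h⟩
    · exact ⟨tr hut htT, List.prefix_or_prefix_of_prefix h hut⟩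
    · exact ⟨tr hut htT, Or.inr (hut.trans h)⟩
  · rintro u ⟨huT, h⟩
    have : ∃ w ∈ T, s <+: w ∧ u <+: w := by
      rcases h with h | h
      · exact ⟨u, huT, h, List.prefix_refl u⟩
      · exact ⟨s, hs, List.prefix_refl s, h⟩
    obtain ⟨w, hw, hsw, huw⟩ := this
    obtain ⟨t, htT, hwt, h0, h1⟩ := hb w hw
    have hst := hsw.trans hwt
    exact ⟨t, ⟨htT, Or.inl hst⟩, huw.trans hwt,
      ⟨h0, Or.inl (hst.trans (List.prefix_append _ _))⟩,
      ⟨h1, Or.inl (hst.trans (List.prefix_append _ _))⟩⟩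

theorem splitOne_mem {J : Set (Set (List Bool))}
    (hJperf : ∀ T ∈ J, IsPerfect T)
    (hJclopen : ∀ T ∈ J, ∀ S : Set (List Bool), IsPerfect S → ClopenIn S T → S ∈ J)
    {T : Set (List Bool)} (hT : T ∈ J) (i : Bool) : splitOne T i ∈ J := by
  have hr := (root_spec (hJperf T hT)).1 i
  refine hJclopen T hT _ (restr_perfect (hJperf T hT) hr) ⟨{root T ++ [i]}, by simp, by simpa using hr, ?_⟩
  simp [splitOne]

theorem sys_anti {Tf : List Bool → Set (List Bool)} (hTf : IsSplittingSystem Tf)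
    (v w : List Bool) : Tf (v ++ w) ⊆ Tf v := by
  induction w using List.reverseRecOn with
  | nil => simp
  | append_singleton w i ih =>
    rw [← List.append_assoc]
    exact fun x hx => ih (hTf.2 _ _ hx).1

theorem sys_root_step {Tf : List Bool → Set (List Bool)} (hTf : IsSplittingSystem Tf)
    (v : List Bool) (i : Bool) :
    root (Tf v) ++ [i] <+: root (Tf (v ++ [i])) := by
  apply comp_prefix
  intro j
  exact (hTf.2 v i ((root_spec (hTf.1 (v ++ [i]))).1 j)).2

theorem sys_root {Tf : List Bool → Set (List Bool)} (hTf : IsSplittingSystem Tf)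
    (v w : List Bool) : root (Tf v) <+: root (Tf (v ++ w)) := by
  induction w using List.reverseRecOn with
  | nil => simp
  | append_singleton w i ih =>
    rw [← List.append_assoc]
    exact ih.trans ((List.prefix_append _ _).trans (sys_root_step hTf _ _))

theorem sys_root_length {Tf : List Bool → Set (List Bool)} (hTf : IsSplittingSystem Tf)
    (v : List Bool) : v.length ≤ (root (Tf v)).length := by
  induction v using List.reverseRecOn with
  | nil => simp
  | append_singleton w i ih =>
    have := (sys_root_step hTf w i).length_le
    simp at this ⊢
    omega

theorem sys_inj {Tf : List Bool → Set (List Bool)} (hTf : IsSplittingSystem Tf)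
    (a : ℕ → Bool) (u : List Bool) : ∀ v : List Bool, u.length = v.length →
    a ∈ branches (Tf u) → a ∈ branches (Tf v) → u = v := by
  induction u using List.reverseRecOn with
  | nil => intro v h _ _; exact (List.length_eq_zero_iff.1 h.symm).symm
  | append_singleton u i ih =>
    intro v
    induction v using List.reverseRecOn with
    | nil => intro h; simp at h
    | append_singleton v j _ =>
      intro h hu hv
      have e : u = v := ih v (by simpa using h) (fun n => sys_anti hTf _ _ (hu n))
        (fun n => sys_anti hTf _ _ (hv n))
      subst e
      have key : ∀ k : Bool, a ∈ branches (Tf (u ++ [k])) →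
          root (Tf u) ++ [k] = seg a ((root (Tf u)).length + 1) := by
        intro k hk
        rcases (hTf.2 u k (hk ((root (Tf u)).length + 1))).2 with h | h
        · exact h.eq_of_length (by simp [seg_length])
        · exact (h.eq_of_length (by simp [seg_length])).symm
      have := (key i hu).trans (key j hv).symm
      simp at this
      rw [this]

theorem sys_perfect {Tf : List Bool → Set (List Bool)} (hTf : IsSplittingSystem Tf)
    : IsPerfect (⋂ n : ℕ, ⋃ s ∈ {s : List Bool | s.length = n}, Tf s) := by
  refine ⟨?_, ⟨[], ?_⟩, ?_⟩
  · intro s t hst ht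
    simp only [mem_iInter, mem_iUnion, mem_ofPred_eq, exists_prop] at ht ⊢
    intro n
    obtain ⟨u, hu, h⟩ := ht n
    exact ⟨u, hu, (hTf.1 u).1 hst h⟩
  · simp only [mem_iInter, mem_iUnion, mem_ofPred_eq, exists_prop]
    intro n
    refine ⟨List.replicate n false, by simp, ?_⟩
    exact (hTf.1 _).1 List.nil_prefix (hTf.1 _).2.1.some_mem
  · intro s hs
    have hs' := hs
    simp only [mem_iInter, mem_iUnion, mem_ofPred_eq, exists_prop] at hs'
    obtain ⟨u, hu, hsu⟩ := hs' s.length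
    have hsr : s <+: root (Tf u) := by
      rcases (root_spec (hTf.1 u)).2.2 s hsu with h | h
      · have h1 := h.length_le
        have h2 := sys_root_length hTf u
        rw [h.eq_of_length (by omega)]
      · exact h
    have key : ∀ w x, x <+: root (Tf w) →
        x ∈ (⋂ n : ℕ, ⋃ s ∈ {s : List Bool | s.length = n}, Tf s) := by
      intro w x hx
      simp only [mem_iInter, mem_iUnion, mem_ofPred_eq, exists_prop]
      intro m
      have hx' := hx.trans (sys_root hTf w (List.replicate m false))
      have hmem := (hTf.1 _).1 hx' (root_spec (hTf.1 (w ++ List.replicate m false))).2.1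
      rw [← List.take_append_drop m (w ++ List.replicate m false)] at hmem
      exact ⟨_, by simp, sys_anti hTf _ _ hmem⟩
    exact ⟨root (Tf u), key u _ (List.prefix_refl _), hsr,
      key _ _ (sys_root_step hTf u false), key _ _ (sys_root_step hTf u true)⟩

theorem sys_cover {Tf : List Bool → Set (List Bool)} (hTf : IsSplittingSystem Tf)
    (n : ℕ) :
    branches (⋂ m : ℕ, ⋃ s ∈ {s : List Bool | s.length = m}, Tf s) ⊆
      ⋃ S ∈ Set.image Tf {s : List Bool | s.length = n}, branches S := by
  intro a ha
  by_contra hcon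
  simp only [mem_iUnion, mem_image, mem_ofPred_eq, exists_prop, not_exists, not_and] at hcon
  have h1 : ∀ s : List Bool, ∃ k, s.length = n → seg a k ∉ Tf s := by
    intro s
    by_cases hs : s.length = n
    · have h := hcon (Tf s) ⟨s, hs, rfl⟩
      simp only [branches, mem_ofPred_eq, not_forall] at h
      obtain ⟨k, hk⟩ := h
      exact ⟨k, fun _ => hk⟩
    · exact ⟨0, fun h => absurd h hs⟩
  choose k hk using h1
  have hfin : {s : List Bool | s.length = n}.Finite := List.finite_length_eq Bool n
  obtain ⟨K, hK⟩ := (hfin.image k).bddAbove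
  have h2 := ha K
  simp only [mem_iInter, mem_iUnion, mem_ofPred_eq, exists_prop] at h2
  obtain ⟨s, hs, hsK⟩ := h2 n
  exact hk s hs ((hTf.1 s).1 (seg_prefix a (hK ⟨s, hs, rfl⟩)) hsK)


/-- Fusion through dense sets: given `J` closed under clopen perfect subtrees, dense
subsets `D_n ⊆ J` (`n ≥ 1`), and `S⁰ ∈ J`, there is a splitting system in `J` below
`S⁰` meeting each `D_n` at level `n`, whose fusion `T` is a perfect subtree of `S⁰`
finitely covered, with disjoint pieces, by each `D_n`. -/
theorem stmt_13 (J : Set (Set (List Bool)))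
    (hJperf : ∀ T ∈ J, IsPerfect T)
    (hJclopen : ∀ T ∈ J, ∀ S : Set (List Bool), IsPerfect S → ClopenIn S T → S ∈ J)
    (D : ℕ → Set (Set (List Bool)))
    (hDsub : ∀ n, 1 ≤ n → D n ⊆ J)
    (hDdense : ∀ n, 1 ≤ n → ∀ T ∈ J, ∃ S ∈ D n, S ⊆ T)
    (S0 : Set (List Bool)) (hS0 : S0 ∈ J) :
    ∃ Tf : List Bool → Set (List Bool),
      IsSplittingSystem Tf ∧ (∀ s, Tf s ∈ J) ∧ Tf [] ⊆ S0 ∧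
      (∀ s : List Bool, 1 ≤ s.length → Tf s ∈ D s.length) ∧
      IsPerfect (⋂ n : ℕ, ⋃ s ∈ {s : List Bool | s.length = n}, Tf s) ∧
      (⋂ n : ℕ, ⋃ s ∈ {s : List Bool | s.length = n}, Tf s) ⊆ S0 ∧
      (∀ n, 1 ≤ n → ∃ A : Set (Set (List Bool)), A.Finite ∧ A ⊆ D n ∧
        (∀ S ∈ A, ∀ S' ∈ A, S ≠ S' → branches S ∩ branches S' = ∅) ∧
        branches (⋂ m : ℕ, ⋃ s ∈ {s : List Bool | s.length = m}, Tf s) ⊆ ⋃ S ∈ A, branches S) := by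
  classical
  have step : ∀ (T : J) (n : ℕ) (i : Bool), ∃ S : J, S.1 ∈ D (n + 1) ∧ S.1 ⊆ splitOne T.1 i := by
    intro T n i
    obtain ⟨S, hS, hST⟩ := hDdense (n + 1) (by omega) _ (splitOne_mem hJperf hJclopen T.2 i)
    exact ⟨⟨S, hDsub _ (by omega) hS⟩, hS, hST⟩
  choose f hf1 hf2 using step
  let g : List Bool → J := fun l => List.rec ⟨S0, hS0⟩ (fun i l T => f T l.length i) l
  have hgc : ∀ i l, g (i :: l) = f (g l) l.length i := fun _ _ => rfl
  have hg0 : (g []).1 = S0 := rfl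
  let Tf : List Bool → Set (List Bool) := fun s => (g s.reverse).1
  have hsys : IsSplittingSystem Tf := by
    refine ⟨fun s => hJperf _ (g s.reverse).2, fun s i => ?_⟩
    simp only [Tf, List.reverse_append, List.reverse_singleton, List.singleton_append, hgc]
    exact hf2 _ _ _
  have hD : ∀ s : List Bool, 1 ≤ s.length → Tf s ∈ D s.length := by
    intro s
    induction s using List.reverseRecOn with
    | nil => intro h; simp at h
    | append_singleton s i _ =>
      intro _
      simp only [Tf, List.reverse_append, List.reverse_singleton, List.singleton_append, hgc]
      have := hf1 (g s.reverse) s.reverse.length i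
      simpa using this
  refine ⟨Tf, hsys, fun s => (g s.reverse).2, subset_of_eq hg0, hD, sys_perfect hsys, ?_, ?_⟩
  · intro x hx
    simp only [mem_iInter, mem_iUnion, mem_ofPred_eq, exists_prop] at hx
    obtain ⟨s, hs, hx⟩ := hx 0
    rw [List.length_eq_zero_iff] at hs
    subst hs
    exact hx
  · intro n hn
    refine ⟨Set.image Tf {s : List Bool | s.length = n}, (List.finite_length_eq Bool n).image _, ?_, ?_,
      sys_cover hsys n⟩
    · rintro _ ⟨s, hs, rfl⟩
      have hs' : s.length = n := hs
      rw [← hs']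
      exact hD s (by omega)
    · rintro _ ⟨s, hs, rfl⟩ _ ⟨t, ht, rfl⟩ hne
      rw [Set.eq_empty_iff_forall_notMem]
      rintro a ⟨h1, h2⟩
      have hs' : s.length = n := hs
      have ht' : t.length = n := ht
      exact hne (by rw [sys_inj hsys a s t (by omega) h1 h2])
end

section
/- Let T be a perfect tree and A a finite set of perfect trees with pairwise disjoint branch sets ([S] ∩ [S'] = ∅ for distinct S, S' ∈ A) such that [T] ⊆ ⋃_{S∈A} [S]. Then there exist a string s ∈ T and a tree S ∈ A with T↾s ⊆ S. -/
open Set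

theorem ext_one {T : Set (List Bool)} (hT : IsPerfect T) (s : List Bool) (hs : s ∈ T) :
    ∃ i : Bool, s ++ [i] ∈ T := by
  obtain ⟨t, ht, ⟨r, rfl⟩, h0, -⟩ := hT.2.2 s hs
  cases r with
  | nil => exact ⟨false, by simpa using h0⟩
  | cons i r => exact ⟨i, hT.1 ⟨r, by simp⟩ ht⟩

theorem exists_branch {T : Set (List Bool)} (hT : IsPerfect T) (u : List Bool) (hu : u ∈ T) :
    ∃ a ∈ branches T, seg a u.length = u := by
  choose! g hg using ext_one hT
  let f : ℕ → List Bool := fun n => Nat.rec u (fun _ l => l ++ [g l]) n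
  have f0 : f 0 = u := rfl
  have fs : ∀ n, f (n+1) = f n ++ [g (f n)] := fun n => rfl
  have fT : ∀ n, f n ∈ T := by
    intro n
    induction n with
    | zero => exact hu
    | succ n ih => rw [fs]; exact hg _ ih
  have fl : ∀ n, (f n).length = u.length + n := by
    intro n
    induction n with
    | zero => simp [f0]
    | succ n ih => rw [fs]; simp [ih]; omega
  have fp : ∀ m k, f m <+: f (m + k) := by
    intro m k
    induction k with
    | zero => simp
    | succ k ih => exact ih.trans (by rw [← Nat.add_assoc, fs]; simp)
  let a : ℕ → Bool := fun k => (f (k+1)).getD k false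
  have key : ∀ n, seg a n = (f n).take n := by
    intro n
    apply List.ext_getElem
    · simp [seg, fl]
    · intro k h1 h2
      have hk : k < n := by simpa [seg] using h1
      have hp := fp (k+1) (n - (k+1))
      rw [Nat.add_sub_cancel' hk] at hp
      have hl : k < (f (k+1)).length := by have := fl (k+1); omega
      have := hp.getElem hl
      simp only [seg, List.getElem_map, List.getElem_range, List.getElem_take, a]
      rw [List.getD_eq_getElem _ _ hl, this]
  refine ⟨a, fun n => ?_, ?_⟩
  · rw [key]
    exact hT.1 (List.take_prefix _ _) (fT n)
  · rw [key]
    have := fp 0 u.length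
    rw [f0, Nat.zero_add] at this
    exact (List.prefix_iff_eq_take.1 this).symm

/-- If `[T]` is covered by a finite family of perfect trees with pairwise disjoint
branch sets, then some restriction `T↾s` is contained in one member of the family. -/
theorem stmt_14 (T : Set (List Bool)) (hT : IsPerfect T)
    (A : Set (Set (List Bool))) (hfin : A.Finite) (hperf : ∀ S ∈ A, IsPerfect S)
    (hdisj : ∀ S ∈ A, ∀ S' ∈ A, S ≠ S' → branches S ∩ branches S' = ∅)
    (hcov : branches T ⊆ ⋃ S ∈ A, branches S) :
    ∃ s ∈ T, ∃ S ∈ A, restr T s ⊆ S := by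
  by_contra hcon
  push Not at hcon
  have step : ∃ u ∈ T, ∀ S ∈ A, u ∉ S := by
    have : ∀ B : Set (Set (List Bool)), B.Finite → B ⊆ A → ∃ u ∈ T, ∀ S ∈ B, u ∉ S := by
      intro B hB
      induction B, hB using Set.Finite.induction_on with
      | empty =>
        intro _
        obtain ⟨u, hu⟩ := hT.2.1
        exact ⟨u, hu, by simp⟩
      | @insert S B _ _ ih =>
        intro hBA
        obtain ⟨u, hu, h⟩ := ih ((Set.subset_insert _ _).trans hBA)
        have hSA : S ∈ A := hBA (Set.mem_insert _ _)
        obtain ⟨t, ⟨htT, ht⟩, htS⟩ := Set.not_subset.1 (hcon u hu S hSA)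
        rcases ht with ht | ht
        · refine ⟨t, htT, ?_⟩
          rintro S' (rfl | hS')
          · exact htS
          · exact fun h' => h S' hS' ((hperf S' (hBA (Set.mem_insert_of_mem _ hS'))).1 ht h')
        · refine ⟨u, hu, ?_⟩
          rintro S' (rfl | hS')
          · exact fun h' => htS ((hperf _ hSA).1 ht h')
          · exact h S' hS'
    exact this A hfin subset_rfl
  obtain ⟨u, hu, h⟩ := step
  obtain ⟨a, ha, hau⟩ := exists_branch hT u hu
  obtain ⟨S, hS, haS⟩ := Set.mem_iUnion₂.1 (hcov ha)
  exact h S hS (hau ▸ haS u.length)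
end
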